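/- For every real x with 0 < x < 1 and real s ≥ 1: ∑_{n≥1} p(n) x^n · E(X_{s,n}) = g(x) · h_s(x), where h_s(x) = ∑_{1 ≤ j ≤ s} j x^j/(1 − x^j) and g(x) = ∏_{k≥1}(1−x^k)^{-1}. -/

import Mathlib

/-- `X_{s,n}(λ)`: total size contributed by parts of `λ` of size at most `s`.
Since all parts are at most `n`, this agrees with the paper's convention
`X_{s,n} = n` for `s > n`. -/
noncomputable def Xsn (s : ℝ) {n : ℕ} (lam : Nat.Partition n) : ℕ :=
  (lam.parts.filter (fun j => j ≤ ⌊s⌋₊)).sum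

open Filter Topology

/-- Summing a weight over the partitions of `n`: those containing the part `j` correspond, by
removing one copy of `j`, to the partitions of `n - j`. -/
theorem Nat.Partition.sum_eq_sum_notMem_add_sum_cons {j : ℕ} (hj : 0 < j) (φ : Multiset ℕ → ℝ)
    (n : ℕ) :
    ∑ p : n.Partition, φ p.parts = ∑ p : n.Partition, (if j ∈ p.parts then 0 else φ p.parts) +
      if j ≤ n then ∑ q : (n - j).Partition, φ (j ::ₘ q.parts) else 0 := by
  have hsplit : ∑ p : n.Partition, φ p.parts =
      ∑ p : n.Partition, (if j ∈ p.parts then 0 else φ p.parts) +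
        ∑ p : n.Partition with j ∈ p.parts, φ p.parts := by
    rw [Finset.sum_filter, ← Finset.sum_add_distrib]
    exact Finset.sum_congr rfl fun p _ => by split_ifs <;> simp
  rw [hsplit]
  congr 1
  split_ifs with hjn
  · symm
    refine Finset.sum_bij (fun q _ => (⟨j ::ₘ q.parts, ?_, ?_⟩ : n.Partition)) ?_ ?_ ?_ ?_
    · intro i hi
      rcases Multiset.mem_cons.1 hi with rfl | hi
      · exact hj
      · exact q.parts_pos hi
    · rw [Multiset.sum_cons, q.parts_sum]
      omega
    · intro q _
      simp
    · intro q _ r _ h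
      exact Nat.Partition.ext ((Multiset.cons_inj_right j).1 (congrArg Nat.Partition.parts h))
    · intro p hp
      have hjp : j ∈ p.parts := (Finset.mem_filter.1 hp).2
      refine ⟨⟨p.parts.erase j, fun hi => p.parts_pos (Multiset.mem_of_mem_erase hi), ?_⟩,
        Finset.mem_univ _, ?_⟩
      · have h := congrArg Multiset.sum (Multiset.cons_erase hjp)
        rw [Multiset.sum_cons, p.parts_sum] at h
        omega
      · exact Nat.Partition.ext (Multiset.cons_erase hjp)
    · intro q _
      rfl
  · refine Finset.sum_eq_zero fun p hp => absurd ?_ hjn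
    exact p.le_of_mem_parts (Finset.mem_filter.1 hp).2

/-- If `a n = b n + a (n - j)`, then the generating functions satisfy `A = B / (1 - x ^ j)`. -/
theorem hasSum_mul_pow_of_recurrence {x : ℝ} (hx0 : 0 < x) (hx1 : x < 1) {j : ℕ} (hj : 0 < j)
    {a b : ℕ → ℝ} (hb : ∀ n, 0 ≤ b n) (hab : ∀ n, a n = b n + if j ≤ n then a (n - j) else 0)
    {F : ℝ} (hF : HasSum (fun n => b n * x ^ n) F) :
    HasSum (fun n => a n * x ^ n) (F * (1 - x ^ j)⁻¹) := by
  have hxj : 0 < 1 - x ^ j := sub_pos.2 (pow_lt_one₀ hx0.le hx1 hj.ne')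
  have ha : ∀ n, 0 ≤ a n := by
    intro n
    induction n using Nat.strong_induction_on with
    | _ n ih =>
      rw [hab]
      split_ifs with h
      · exact add_nonneg (hb n) (ih _ (by omega))
      · simpa using hb n
  have ha' : ∀ n, 0 ≤ a n * x ^ n := fun n => mul_nonneg (ha n) (by positivity)
  have hshift : ∀ n, a (j + n) * x ^ (j + n) = b (j + n) * x ^ (j + n) + x ^ j * (a n * x ^ n) := by
    intro n
    rw [hab (j + n), if_pos (Nat.le_add_right j n), Nat.add_sub_cancel_left, pow_add]
    ring
  have hinit : ∀ n ∈ Finset.range j, a n * x ^ n = b n * x ^ n := by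
    intro n hn
    rw [hab n, if_neg (by simpa using hn), add_zero]
  have hpartial : ∀ N, ∑ n ∈ Finset.range (j + N), a n * x ^ n =
      ∑ n ∈ Finset.range (j + N), b n * x ^ n + x ^ j * ∑ n ∈ Finset.range N, a n * x ^ n := by
    intro N
    rw [Finset.sum_range_add, Finset.sum_range_add, Finset.sum_congr rfl hinit,
      Finset.sum_congr rfl fun n _ => hshift n, Finset.sum_add_distrib, Finset.mul_sum, add_assoc]
  have hsum : Summable fun n => a n * x ^ n := by
    refine summable_of_sum_range_le (c := F * (1 - x ^ j)⁻¹) ha' fun N => ?_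
    rw [← div_eq_mul_inv, le_div_iff₀ hxj]
    have h1 : ∑ n ∈ Finset.range N, a n * x ^ n ≤ ∑ n ∈ Finset.range (j + N), a n * x ^ n :=
      Finset.sum_le_sum_of_subset_of_nonneg (Finset.range_mono (Nat.le_add_left N j))
        fun n _ _ => ha' n
    have h2 : ∑ n ∈ Finset.range (j + N), b n * x ^ n ≤ F :=
      sum_le_hasSum _ (fun n _ => mul_nonneg (hb n) (by positivity)) hF
    linarith [hpartial N]
  have hlim := hsum.hasSum.tendsto_sum_nat
  have hadd : Tendsto (fun N : ℕ => j + N) atTop atTop := tendsto_atTop_mono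
    (fun N => Nat.le_add_left N j) tendsto_id
  have heq : ∑' n, a n * x ^ n = F + x ^ j * ∑' n, a n * x ^ n := by
    refine tendsto_nhds_unique (hlim.comp hadd) ?_
    refine Tendsto.congr (fun N => (hpartial N).symm) ?_
    exact (hF.tendsto_sum_nat.comp hadd).add (hlim.const_mul _)
  have hval : F * (1 - x ^ j)⁻¹ = ∑' n, a n * x ^ n := by
    rw [← div_eq_mul_inv, div_eq_iff hxj.ne']
    linarith
  rw [hval]
  exact hsum.hasSum

/-- The generating function of partitions with all parts at most `k`. -/
theorem hasSum_card_partition_parts_le {x : ℝ} (hx0 : 0 < x) (hx1 : x < 1) (k : ℕ) :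
    HasSum (fun n => (∑ p : Nat.Partition n, if ∀ i ∈ p.parts, i ≤ k then (1 : ℝ) else 0) * x ^ n)
      (∏ i ∈ Finset.range k, (1 - x ^ (i + 1))⁻¹) := by
  induction k with
  | zero =>
    rw [Finset.prod_range_zero]
    convert hasSum_ite_eq (0 : ℕ) (1 : ℝ) using 2 with n
    split_ifs with hn
    · subst hn
      simp
    · rw [Finset.sum_eq_zero, zero_mul]
      intro p _
      refine if_neg fun h => hn ?_
      rw [← p.parts_sum]
      exact Multiset.sum_eq_zero fun i hi => Nat.le_zero.1 (h i hi)
  | succ k ih =>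
    rw [Finset.prod_range_succ]
    refine hasSum_mul_pow_of_recurrence hx0 hx1 k.succ_pos
      (fun n => Finset.sum_nonneg fun p _ => by split_ifs <;> norm_num) (fun n => ?_) ih
    rw [Nat.Partition.sum_eq_sum_notMem_add_sum_cons k.succ_pos
      (fun m => if ∀ i ∈ m, i ≤ k + 1 then (1 : ℝ) else 0)]
    congr 1
    · refine Finset.sum_congr rfl fun p _ => ?_
      rw [← ite_not, ← ite_and]
      refine if_congr ⟨fun h i hi => ?_, fun h => ⟨fun hk => ?_, fun i hi => ?_⟩⟩ rfl rfl
      · have := h.2 i hi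
        have : i ≠ k + 1 := by
          rintro rfl
          exact h.1 hi
        omega
      · have := h _ hk
        omega
      · have := h i hi
        omega
    · simp

theorem multipliable_inv_one_sub_pow {x : ℝ} (hx0 : 0 < x) (hx1 : x < 1) :
    Multipliable fun i : ℕ => (1 - x ^ (i + 1))⁻¹ := by
  have hpos : ∀ i : ℕ, 0 < 1 - x ^ (i + 1) := fun i =>
    sub_pos.2 (pow_lt_one₀ hx0.le hx1 i.succ_ne_zero)
  have hs : Summable fun i : ℕ => x ^ (i + 1) / (1 - x ^ (i + 1)) := by
    refine Summable.of_nonneg_of_le (fun i => div_nonneg (by positivity) (hpos i).le) (fun i => ?_)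
      ((summable_geometric_of_lt_one hx0.le hx1).mul_right (1 - x)⁻¹)
    rw [← div_eq_mul_inv]
    have h1 : x ^ (i + 1) ≤ x := pow_le_of_le_one hx0.le hx1.le i.succ_ne_zero
    have h2 : x ^ (i + 1) ≤ x ^ i := pow_le_pow_of_le_one hx0.le hx1.le i.le_succ
    exact div_le_div₀ (by positivity) h2 (by linarith) (by linarith)
  refine (Real.multipliable_one_add_of_summable hs).congr fun i => ?_
  have := (hpos i).ne'
  field_simp
  ring

/-- Euler's generating function for partitions, at a real point of `(0, 1)`. -/
theorem hasSum_card_partition {x : ℝ} (hx0 : 0 < x) (hx1 : x < 1) :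
    HasSum (fun n => (Fintype.card (Nat.Partition n) : ℝ) * x ^ n)
      (∏' i : ℕ, (1 - x ^ (i + 1))⁻¹) := by
  have hle : ∀ k n, (∑ p : Nat.Partition n, if ∀ i ∈ p.parts, i ≤ k then (1 : ℝ) else 0) * x ^ n ≤
      (Fintype.card (Nat.Partition n) : ℝ) * x ^ n := by
    intro k n
    refine mul_le_mul_of_nonneg_right ?_ (by positivity)
    rw [Fintype.card, Finset.cast_card]
    exact Finset.sum_le_sum fun p _ => by split_ifs <;> norm_num
  have heq : ∀ k n, n ≤ k →
      (∑ p : Nat.Partition n, if ∀ i ∈ p.parts, i ≤ k then (1 : ℝ) else 0) =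
        Fintype.card (Nat.Partition n) := by
    intro k n hnk
    rw [Fintype.card, Finset.cast_card]
    exact Finset.sum_congr rfl fun p _ => if_pos fun i hi => (p.le_of_mem_parts hi).trans hnk
  have hlim := (multipliable_inv_one_sub_pow hx0 hx1).hasProd.tendsto_prod_nat
  have hmono : Monotone fun k => ∏ i ∈ Finset.range k, (1 - x ^ (i + 1))⁻¹ := by
    refine monotone_nat_of_le_succ fun k => ?_
    have hpos : ∀ i : ℕ, 0 < 1 - x ^ (i + 1) := fun i =>
      sub_pos.2 (pow_lt_one₀ hx0.le hx1 i.succ_ne_zero)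
    rw [Finset.prod_range_succ]
    refine le_mul_of_one_le_right (Finset.prod_nonneg fun i _ => (inv_pos.2 (hpos i)).le) ?_
    exact (one_le_inv₀ (hpos k)).2 (sub_le_self _ (by positivity))
  have hbound : ∀ N, ∑ n ∈ Finset.range N, (Fintype.card (Nat.Partition n) : ℝ) * x ^ n ≤
      ∏' i : ℕ, (1 - x ^ (i + 1))⁻¹ := by
    intro N
    refine le_trans ?_ (hmono.ge_of_tendsto hlim N)
    refine (Finset.sum_congr rfl fun n hn => ?_).trans_le (sum_le_hasSum _ (fun n _ => mul_nonneg (Finset.sum_nonneg fun p _ => ?_) (by positivity))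
      (hasSum_card_partition_parts_le hx0 hx1 N))
    · rw [heq N n (Finset.mem_range.1 hn).le]
    · split_ifs <;> norm_num
  have hsum := summable_of_sum_range_le (fun n => by positivity) hbound
  have hval : ∑' n, (Fintype.card (Nat.Partition n) : ℝ) * x ^ n =
      ∏' i : ℕ, (1 - x ^ (i + 1))⁻¹ :=
    le_antisymm (hsum.tsum_le_of_sum_range_le hbound)
      (le_of_tendsto' hlim fun k =>
        hasSum_le (hle k) (hasSum_card_partition_parts_le hx0 hx1 k) hsum.hasSum)
  exact hval ▸ hsum.hasSum

/-- The generating function of the total multiplicity of the part `j`. -/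
theorem hasSum_count_partition {x : ℝ} (hx0 : 0 < x) (hx1 : x < 1) {j : ℕ} (hj : 0 < j) :
    HasSum (fun n => (∑ p : Nat.Partition n, (p.parts.count j : ℝ)) * x ^ n)
      ((∏' i : ℕ, (1 - x ^ (i + 1))⁻¹) * (x ^ j / (1 - x ^ j))) := by
  have hF : HasSum
      (fun n => (if j ≤ n then (Fintype.card (Nat.Partition (n - j)) : ℝ) else 0) * x ^ n)
      ((∏' i : ℕ, (1 - x ^ (i + 1))⁻¹) * x ^ j) := by
    rw [← (add_left_injective j).hasSum_iff]
    · refine ((hasSum_card_partition hx0 hx1).mul_right (x ^ j)).congr_fun fun n => ?_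
      simp [pow_add, mul_assoc]
    · intro n hn
      rw [if_neg fun h => hn ⟨n - j, Nat.sub_add_cancel h⟩, zero_mul]
  rw [div_eq_mul_inv, ← mul_assoc]
  refine hasSum_mul_pow_of_recurrence hx0 hx1 hj (fun n => by split_ifs <;> positivity)
    (fun n => ?_) hF
  rw [Nat.Partition.sum_eq_sum_notMem_add_sum_cons hj (fun m => (m.count j : ℝ)),
    Finset.sum_eq_zero, zero_add]
  · split_ifs
    · simp [Finset.sum_add_distrib, add_comm]
    · simp
  · intro p _
    split_ifs with h
    · rfl
    · simp [Multiset.count_eq_zero_of_notMem h]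

theorem Xsn_eq_sum_count (s : ℝ) {n : ℕ} (p : Nat.Partition n) :
    Xsn s p = ∑ j ∈ Finset.Icc 1 ⌊s⌋₊, j * p.parts.count j := by
  rw [Xsn, Finset.sum_multiset_count_of_subset _ (Finset.Icc 1 ⌊s⌋₊)]
  · refine Finset.sum_congr rfl fun j hj => ?_
    rw [Multiset.count_filter_of_pos (p := fun j => j ≤ ⌊s⌋₊) (Finset.mem_Icc.1 hj).2, smul_eq_mul, mul_comm]
  · intro j hj
    obtain ⟨hjp, hjs⟩ := Multiset.mem_filter.1 (Multiset.mem_toFinset.1 hj)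
    exact Finset.mem_Icc.2 ⟨p.parts_pos hjp, hjs⟩

/-- For `0 < x < 1`, `s ≥ 1`:
`∑_{n≥1} p(n) xⁿ E(X_{s,n}) = g(x) h_s(x)` where `h_s(x) = ∑_{1≤j≤s} j xʲ/(1−xʲ)`. -/
theorem egf_expectation_Xsn (x : ℝ) (hx0 : 0 < x) (hx1 : x < 1) (s : ℝ) (hs : 1 ≤ s) :
    ∑' n : ℕ+, (Fintype.card (Nat.Partition (n : ℕ)) : ℝ) * x ^ (n : ℕ) *
        ((Fintype.card (Nat.Partition (n : ℕ)) : ℝ)⁻¹ *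
          ∑ lam : Nat.Partition (n : ℕ), (Xsn s lam : ℝ))
      = (∏' k : ℕ+, (1 - x ^ (k : ℕ))⁻¹) *
        ∑ j ∈ Finset.Icc 1 ⌊s⌋₊, (j : ℝ) * x ^ j / (1 - x ^ j) := by
  have hsum : HasSum (fun n => (∑ p : Nat.Partition n, (Xsn s p : ℝ)) * x ^ n)
      ((∏' i : ℕ, (1 - x ^ (i + 1))⁻¹) *
        ∑ j ∈ Finset.Icc 1 ⌊s⌋₊, (j : ℝ) * x ^ j / (1 - x ^ j)) := by
    rw [Finset.mul_sum]
    have h := hasSum_sum fun (j : ℕ) (hj : j ∈ Finset.Icc 1 ⌊s⌋₊) =>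
      (hasSum_count_partition hx0 hx1 (Finset.mem_Icc.1 hj).1).mul_left (j : ℝ)
    simp_rw [mul_left_comm _ (∏' i : ℕ, (1 - x ^ (i + 1))⁻¹), ← mul_div_assoc (_ : ℝ) (x ^ _)] at h
    refine h.congr_fun fun n => ?_
    simp_rw [Xsn_eq_sum_count, Nat.cast_sum, Nat.cast_mul]
    rw [Finset.sum_comm, Finset.sum_mul]
    simp_rw [← Finset.mul_sum, mul_assoc]
  rw [tprod_pnat_eq_tprod_succ (f := fun k => (1 - x ^ k)⁻¹), ← hsum.tsum_eq,
    ← tsum_pnat_eq_tsum_of_eq_zero]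
  · refine tsum_congr fun n => ?_
    have hcard : (Fintype.card (Nat.Partition (n : ℕ)) : ℝ) ≠ 0 :=
      Nat.cast_ne_zero.2 Fintype.card_ne_zero
    field_simp
  · simp [Xsn]
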